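/- Let C be a finite type, let c0 and c1 be distributions on C (the conditional distributions of the construct given Z = 0 and Z = 1), and let w0, w1 > 0 with w0 + w1 = 1 (the probabilities of Z = 0 and Z = 1). Then there exists a joint distribution μ on C × C × Bool (construct, prediction, protected attribute) such that Pr[Z = z] = w_z, the conditional distribution of the construct given Z = z equals c_z, μ satisfies demographic parity, and the construct accuracy of μ equals 1 − (1/2) · dTV(c0, c1). -/

import Mathlib

/-- A probability distribution on a finite type: nonnegative and summing to 1. -/
def IsDist {Y : Type*} [Fintype Y] (p : Y → ℝ) : Prop :=
  (∀ y, 0 ≤ p y) ∧ ∑ y, p y = 1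

/-- Total variation distance between two distributions on a finite type. -/
noncomputable def dTV {Y : Type*} [Fintype Y] (p q : Y → ℝ) : ℝ :=
  (1 / 2) * ∑ y, |p y - q y|

/-- In a joint distribution `μ` on construct × prediction × protected attribute,
the probability that the protected attribute `Z` equals `z`. -/
def prZ {C P : Type*} [Fintype C] [Fintype P] (μ : C × P × Bool → ℝ) (z : Bool) : ℝ :=
  ∑ c, ∑ p, μ (c, p, z)

/-- The conditional distribution of the prediction given `Z = z`. -/
noncomputable def predCond {C P : Type*} [Fintype C] [Fintype P]
    (μ : C × P × Bool → ℝ) (z : Bool) : P → ℝ :=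
  fun p => (∑ c, μ (c, p, z)) / prZ μ z

/-- The conditional distribution of the construct given `Z = z`. -/
noncomputable def consCond {C P : Type*} [Fintype C] [Fintype P]
    (μ : C × P × Bool → ℝ) (z : Bool) : C → ℝ :=
  fun c => (∑ p, μ (c, p, z)) / prZ μ z

/-- The probability that the construct equals the prediction, conditioned on `Z = z`. -/
noncomputable def prAgree {C : Type*} [Fintype C] (μ : C × C × Bool → ℝ) (z : Bool) : ℝ :=
  (∑ c, μ (c, c, z)) / prZ μ z

/-- The construct accuracy of a model: the average of the two group-conditional
probabilities that the construct equals the prediction. -/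
noncomputable def constructAccuracy {C : Type*} [Fintype C] (μ : C × C × Bool → ℝ) : ℝ :=
  (1 / 2) * (prAgree μ false + prAgree μ true)

/-- Maximal coupling of two distributions on a finite type. -/
theorem exists_maximal_coupling {C : Type*} [Fintype C] (a b : C → ℝ)
    (ha : IsDist a) (hb : IsDist b) :
    ∃ K : C → C → ℝ, (∀ c p, 0 ≤ K c p) ∧ (∀ c, ∑ p, K c p = a c) ∧
      (∀ p, ∑ c, K c p = b p) ∧ ∑ c, K c c = 1 - dTV b a := by
  classical
  obtain ⟨ha0, ha1⟩ := ha
  obtain ⟨hb0, hb1⟩ := hb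
  set m : C → ℝ := fun c => min (a c) (b c) with hm
  have hma : ∀ c, 0 ≤ a c - m c := fun c => sub_nonneg.2 (min_le_left _ _)
  have hmb : ∀ c, 0 ≤ b c - m c := fun c => sub_nonneg.2 (min_le_right _ _)
  have hm0 : ∀ c, 0 ≤ m c := fun c => le_min (ha0 c) (hb0 c)
  set d : ℝ := 1 - ∑ c, m c with hd
  have hda : ∑ c, (a c - m c) = d := by rw [Finset.sum_sub_distrib, ha1]
  have hdb : ∑ c, (b c - m c) = d := by rw [Finset.sum_sub_distrib, hb1]
  have hd0 : 0 ≤ d := hda ▸ Finset.sum_nonneg fun c _ => hma c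
  have hza : ∀ c, (a c - m c) * d / d = a c - m c := by
    intro c
    by_cases h : d = 0
    · have := (Finset.sum_eq_zero_iff_of_nonneg fun c _ => hma c).1 (hda.trans h) c
        (Finset.mem_univ c)
      simp [this]
    · field_simp
  have hzb : ∀ c, d * (b c - m c) / d = b c - m c := by
    intro c
    by_cases h : d = 0
    · have := (Finset.sum_eq_zero_iff_of_nonneg fun c _ => hmb c).1 (hdb.trans h) c
        (Finset.mem_univ c)
      simp [this]
    · field_simp
  have hprod : ∀ c, (a c - m c) * (b c - m c) = 0 := by
    intro c
    rcases le_total (a c) (b c) with h | h <;> simp [hm, h]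
  refine ⟨fun c p => (if c = p then m c else 0) + (a c - m c) * (b p - m p) / d, ?_, ?_, ?_, ?_⟩
  · intro c p
    have h1 : 0 ≤ (if c = p then m c else 0) := by
      split_ifs
      · exact hm0 c
      · exact le_rfl
    exact add_nonneg h1 (div_nonneg (mul_nonneg (hma c) (hmb p)) hd0)
  · intro c
    rw [Finset.sum_add_distrib, ← Finset.sum_div, ← Finset.mul_sum, hdb, hza]
    simp
  · intro p
    rw [Finset.sum_add_distrib, ← Finset.sum_div, ← Finset.sum_mul, hda, hzb]
    simp
  · have habs : ∀ c, |b c - a c| = (a c - m c) + (b c - m c) := by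
      intro c
      rcases le_total (a c) (b c) with h | h
      · simp [hm, h, abs_of_nonneg]
      · rw [abs_of_nonpos (by linarith)]; simp [hm, h]
    simp only [hprod, dTV, habs, Finset.sum_add_distrib (f := fun c => a c - m c), hda, hdb]
    simp
    rw [hd]; ring

/-- Given conditional construct distributions `c0, c1` and group weights
`w0, w1 > 0` with `w0 + w1 = 1`, there is a joint distribution `μ` on
construct × prediction × Z realizing these data that satisfies demographic parity and
attains construct accuracy exactly `1 - (1/2) · dTV(c0, c1)`. -/
theorem exists_demographic_parity_model_attaining_accuracy_bound
    {C : Type*} [Fintype C] (c0 c1 : C → ℝ) (hc0 : IsDist c0) (hc1 : IsDist c1)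
    (w0 w1 : ℝ) (hw0 : 0 < w0) (hw1 : 0 < w1) (hw : w0 + w1 = 1) :
    ∃ μ : C × C × Bool → ℝ, IsDist μ ∧
      prZ μ false = w0 ∧ prZ μ true = w1 ∧
      consCond μ false = c0 ∧ consCond μ true = c1 ∧
      predCond μ false = predCond μ true ∧
      constructAccuracy μ = 1 - (1 / 2) * dTV c0 c1 := by
  classical
  obtain ⟨K, hK0, hKa, hKb, hKd⟩ := exists_maximal_coupling c1 c0 hc1 hc0
  obtain ⟨L, hL0, hLa, hLb, hLd⟩ := exists_maximal_coupling c0 c0 hc0 hc0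
  have hz0 : dTV c0 c0 = 0 := by simp [dTV]
  set μ : C × C × Bool → ℝ :=
    fun x => if x.2.2 then w1 * K x.1 x.2.1 else w0 * L x.1 x.2.1 with hμ
  have p0 : prZ μ false = w0 := by
    simp [prZ, hμ, ← Finset.mul_sum, hLa, hc0.2]
  have p1 : prZ μ true = w1 := by
    simp [prZ, hμ, ← Finset.mul_sum, hKa, hc1.2]
  refine ⟨μ, ⟨?_, ?_⟩, p0, p1, ?_, ?_, ?_, ?_⟩
  · rintro ⟨c, p, z⟩
    cases z
    · simpa [hμ] using mul_nonneg hw0.le (hL0 c p)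
    · simpa [hμ] using mul_nonneg hw1.le (hK0 c p)
  · have : ∑ y, μ y = prZ μ true + prZ μ false := by
      simp [prZ, Fintype.sum_prod_type, Finset.sum_add_distrib]
    rw [this, p0, p1]; linarith
  · funext c
    simp only [consCond, p0]
    simp [hμ, ← Finset.mul_sum, hLa, hw0.ne']
  · funext c
    simp only [consCond, p1]
    simp [hμ, ← Finset.mul_sum, hKa, hw1.ne']
  · funext c
    simp only [predCond, p0, p1]
    simp [hμ, ← Finset.mul_sum, hLb, hKb, hw0.ne', hw1.ne']
  · simp only [constructAccuracy, prAgree, p0, p1]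
    simp [hμ, ← Finset.mul_sum, hLd, hKd, hw0.ne', hw1.ne', hz0]
    ring
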